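/- arXiv:1512.05903 — 4 statements merged into one kernel-verified Lean document; each statement's English description precedes it below -/
import Mathlib

section
/- Let E be a finite-dimensional real inner product space, let M : E → E be an invertible continuous linear map, and let b, e ∈ E with M⁻¹b ≠ 0 and b + e ≠ 0. Then ‖ (M⁻¹b)/‖M⁻¹b‖ − (M⁻¹(b+e))/‖M⁻¹(b+e)‖ ‖ ≤ 2 ‖M‖ ‖M⁻¹‖ ‖e‖ / ‖b + e‖. -/
/-- For an invertible continuous linear map `M` on a finite-dimensional real inner
product space and `b, e` with `M⁻¹b ≠ 0`, `b + e ≠ 0`, the normalised solutions satisfy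
`‖M⁻¹b/‖M⁻¹b‖ − M⁻¹(b+e)/‖M⁻¹(b+e)‖‖ ≤ 2‖M‖‖M⁻¹‖‖e‖/‖b+e‖`. -/
theorem norm_normalized_solution_perturbation
    {E : Type*} [NormedAddCommGroup E] [InnerProductSpace ℝ E] [FiniteDimensional ℝ E]
    (M : E ≃L[ℝ] E) (b e : E) (h1 : M.symm b ≠ 0) (h2 : b + e ≠ 0) :
    ‖‖M.symm b‖⁻¹ • M.symm b - ‖M.symm (b + e)‖⁻¹ • M.symm (b + e)‖ ≤
      2 * ‖(M : E →L[ℝ] E)‖ * ‖(M.symm : E →L[ℝ] E)‖ * ‖e‖ / ‖b + e‖ := by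
  obtain ⟨x, hx⟩ : ∃ x, x = M.symm b := ⟨_, rfl⟩
  obtain ⟨y, hy⟩ : ∃ y, y = M.symm (b + e) := ⟨_, rfl⟩
  have hMy : M y = b + e := by rw [hy]; simp
  have hyx : y - x = M.symm e := by rw [hy, hx, map_add]; abel
  rw [← hx] at h1 ⊢
  rw [← hy]
  have hy0 : y ≠ 0 := by
    rintro rfl
    exact h2 (by rw [← hMy, map_zero])
  have px : 0 < ‖x‖ := norm_pos_iff.2 h1
  have py : 0 < ‖y‖ := norm_pos_iff.2 hy0
  have pb : 0 < ‖b + e‖ := norm_pos_iff.2 h2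
  have e1 : ‖b + e‖ ≤ ‖(M : E →L[ℝ] E)‖ * ‖y‖ := by
    rw [← hMy]; exact (M : E →L[ℝ] E).le_opNorm y
  have e2 : ‖y - x‖ ≤ ‖(M.symm : E →L[ℝ] E)‖ * ‖e‖ := by
    rw [hyx]; exact (M.symm : E →L[ℝ] E).le_opNorm e
  have key : ‖y‖ * ‖‖x‖⁻¹ • x - ‖y‖⁻¹ • y‖ ≤ 2 * ‖y - x‖ := by
    have h : ‖y‖ • (‖x‖⁻¹ • x - ‖y‖⁻¹ • y) = (‖y‖ - ‖x‖) • (‖x‖⁻¹ • x) - (y - x) := by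
      rw [smul_sub, sub_smul, smul_inv_smul₀ px.ne', smul_inv_smul₀ py.ne']
      abel
    have h3 : ‖‖x‖⁻¹ • x‖ = 1 := by
      rw [norm_smul, norm_inv, norm_norm, inv_mul_cancel₀ px.ne']
    calc _ = ‖‖y‖ • (‖x‖⁻¹ • x - ‖y‖⁻¹ • y)‖ := by rw [norm_smul, norm_norm]
      _ ≤ ‖(‖y‖ - ‖x‖) • (‖x‖⁻¹ • x)‖ + ‖y - x‖ := by rw [h]; exact norm_sub_le _ _
      _ ≤ _ := by
        rw [norm_smul, h3, Real.norm_eq_abs]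
        linarith [abs_norm_sub_norm_le y x]
  rw [le_div_iff₀ pb]
  generalize ‖‖x‖⁻¹ • x - ‖y‖⁻¹ • y‖ = D at *
  by_cases hD : D ≤ 0
  · exact (mul_nonpos_of_nonpos_of_nonneg hD pb.le).trans (by positivity)
  push Not at hD
  calc D * ‖b + e‖ ≤ D * (‖(M : E →L[ℝ] E)‖ * ‖y‖) := by gcongr
    _ = ‖(M : E →L[ℝ] E)‖ * (‖y‖ * D) := by ring
    _ ≤ ‖(M : E →L[ℝ] E)‖ * (2 * (‖(M.symm : E →L[ℝ] E)‖ * ‖e‖)) := by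
      exact mul_le_mul_of_nonneg_left (by linarith) (norm_nonneg _)
    _ = _ := by ring
end

section
/- Let H be a finite-dimensional real inner product space, let e₀, e₁ ∈ H be orthonormal vectors, and let A, B be unitary (orthogonal) operators on H that agree on the orthogonal complement of the span of {e₀, e₁} and satisfy ‖A e₁ − B e₁‖ = ‖A e₀ − B e₀‖. Then ‖A − B‖ ≤ √2 ‖A e₀ − B e₀‖. -/
open scoped RealInnerProductSpace

/-- If two unitary operators `A, B` on a finite-dimensional real inner product space
agree on the orthogonal complement of the span of the orthonormal pair `{e₀, e₁}` and
satisfy `‖A e₁ − B e₁‖ = ‖A e₀ − B e₀‖`, then `‖A − B‖ ≤ √2 ‖A e₀ − B e₀‖`. -/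
theorem opNorm_unitary_diff_le
    {H : Type*} [NormedAddCommGroup H] [InnerProductSpace ℝ H] [FiniteDimensional ℝ H]
    (e₀ e₁ : H) (he₀ : ‖e₀‖ = 1) (he₁ : ‖e₁‖ = 1) (horth : ⟪e₀, e₁⟫ = 0)
    (A B : H →L[ℝ] H) (hA : A ∈ unitary (H →L[ℝ] H)) (hB : B ∈ unitary (H →L[ℝ] H))
    (hagree : ∀ v : H, ⟪e₀, v⟫ = 0 → ⟪e₁, v⟫ = 0 → A v = B v)
    (heq : ‖A e₁ - B e₁‖ = ‖A e₀ - B e₀‖) :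
    ‖A - B‖ ≤ Real.sqrt 2 * ‖A e₀ - B e₀‖ := by
  have h00 : ⟪e₀, e₀⟫ = 1 := by rw [real_inner_self_eq_norm_sq, he₀]; norm_num
  have h11 : ⟪e₁, e₁⟫ = 1 := by rw [real_inner_self_eq_norm_sq, he₁]; norm_num
  have horth' : ⟪e₁, e₀⟫ = 0 := by rw [real_inner_comm]; exact horth
  refine ContinuousLinearMap.opNorm_le_bound _ (by positivity) fun x => ?_
  obtain ⟨a, ha⟩ : ∃ a : ℝ, a = ⟪e₀, x⟫ := ⟨_, rfl⟩
  obtain ⟨b, hb⟩ : ∃ b : ℝ, b = ⟪e₁, x⟫ := ⟨_, rfl⟩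
  have ha' : ⟪x, e₀⟫ = a := by rw [real_inner_comm, ha]
  have hb' : ⟪x, e₁⟫ = b := by rw [real_inner_comm, hb]
  have hv := hagree (x - a • e₀ - b • e₁)
    (by simp only [inner_sub_right, inner_smul_right, h00, horth, ← ha]; ring)
    (by simp only [inner_sub_right, inner_smul_right, h11, horth', ← hb]; ring)
  simp only [map_sub, map_smul] at hv
  have hx : (A - B) x = a • (A e₀ - B e₀) + b • (A e₁ - B e₁) := by
    have h2 : A x = B x - a • B e₀ - b • B e₁ + a • A e₀ + b • A e₁ := by
      rw [← hv]; abel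
    rw [ContinuousLinearMap.sub_apply, h2, smul_sub, smul_sub]; abel
  have hbes : a ^ 2 + b ^ 2 ≤ ‖x‖ ^ 2 := by
    have h := real_inner_self_nonneg (x := x - a • e₀ - b • e₁)
    simp only [inner_sub_right, inner_sub_left, inner_smul_right, real_inner_smul_left, h00, h11,
      horth, horth', ← ha, ← hb, ha', hb', real_inner_self_eq_norm_sq x] at h
    nlinarith
  have hab : |a| + |b| ≤ Real.sqrt 2 * ‖x‖ := by
    apply abs_le_of_sq_le_sq' _ (by positivity) |>.2
    rw [mul_pow, Real.sq_sqrt (by norm_num)]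
    nlinarith [sq_abs a, sq_abs b, sq_nonneg (|a| - |b|)]
  calc ‖(A - B) x‖ ≤ ‖a • (A e₀ - B e₀)‖ + ‖b • (A e₁ - B e₁)‖ := by
        rw [hx]; exact norm_add_le _ _
    _ = (|a| + |b|) * ‖A e₀ - B e₀‖ := by
        rw [norm_smul, norm_smul, heq, Real.norm_eq_abs, Real.norm_eq_abs]; ring
    _ ≤ (Real.sqrt 2 * ‖x‖) * ‖A e₀ - B e₀‖ := by gcongr
    _ = Real.sqrt 2 * ‖A e₀ - B e₀‖ * ‖x‖ := by ring
end

section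
/- Let H be a finite-dimensional real inner product space, let e₀, e₁ ∈ H be orthonormal, let ε ≥ 0, and let A, B be unitary (orthogonal) operators on H that agree on the orthogonal complement of the span of {e₀, e₁} and satisfy ‖A e₀ − B e₀‖ ≤ ε and ‖A e₁ − B e₁‖ ≤ ε. Then for any natural number T, any unitary operators U₁, …, U_{T+1} on H, and any unit vector x ∈ H, we have ‖ U_{T+1} A U_T A ⋯ A U₁ x − U_{T+1} B U_T B ⋯ B U₁ x ‖ ≤ √2 T ε. -/
open scoped RealInnerProductSpace

/-- The state of the algorithm after `t` uses of the black-box unitary `A`,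
interspersed with the fixed unitaries `U 0, U 1, …` (so that `U 0` plays the
role of `U₁`, and `hybridProductR A U T = U_{T+1} A U_T A ⋯ A U₁`). -/
noncomputable def hybridProductR {H : Type*} [NormedAddCommGroup H] [InnerProductSpace ℝ H]
    (A : H →L[ℝ] H) (U : ℕ → (H →L[ℝ] H)) : ℕ → (H →L[ℝ] H)
  | 0 => U 0
  | (n + 1) => (U (n + 1)).comp (A.comp (hybridProductR A U n))

/-- Quantum query lower bound inequality: if the unitaries `A, B` agree on the
orthogonal complement of the span of the orthonormal pair `{e₀, e₁}` and are
`ε`-close on `e₀` and `e₁`, then any algorithm making `T` black-box uses of `A`,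
interspersed with arbitrary unitaries, produces a final state moving by at
most `√2 T ε` when `A` is replaced by `B`. -/
theorem query_lower_bound_hybrid
    {H : Type*} [NormedAddCommGroup H] [InnerProductSpace ℝ H] [FiniteDimensional ℝ H]
    (e₀ e₁ : H) (he₀ : ‖e₀‖ = 1) (he₁ : ‖e₁‖ = 1) (horth : ⟪e₀, e₁⟫ = 0)
    (ε : ℝ) (hε : 0 ≤ ε)
    (A B : H →L[ℝ] H) (hA : A ∈ unitary (H →L[ℝ] H)) (hB : B ∈ unitary (H →L[ℝ] H))
    (hagree : ∀ v : H, ⟪e₀, v⟫ = 0 → ⟪e₁, v⟫ = 0 → A v = B v)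
    (h₀ : ‖A e₀ - B e₀‖ ≤ ε) (h₁ : ‖A e₁ - B e₁‖ ≤ ε)
    (T : ℕ) (U : ℕ → (H →L[ℝ] H)) (hU : ∀ i, U i ∈ unitary (H →L[ℝ] H))
    (x : H) (hx : ‖x‖ = 1) :
    ‖hybridProductR A U T x - hybridProductR B U T x‖ ≤ Real.sqrt 2 * T * ε := by
  have key : ∀ v : H, ‖A v - B v‖ ≤ Real.sqrt 2 * ε * ‖v‖ := by
    intro v
    obtain ⟨a, ha⟩ : ∃ a : ℝ, a = ⟪e₀, v⟫ := ⟨_, rfl⟩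
    obtain ⟨b, hb⟩ : ∃ b : ℝ, b = ⟪e₁, v⟫ := ⟨_, rfl⟩
    have h10 : ⟪e₁, e₀⟫ = 0 := by rw [real_inner_comm]; exact horth
    have h00 : ⟪e₀, e₀⟫ = 1 := by rw [real_inner_self_eq_norm_sq, he₀]; norm_num
    have h11 : ⟪e₁, e₁⟫ = 1 := by rw [real_inner_self_eq_norm_sq, he₁]; norm_num
    have ha' : ⟪v, e₀⟫ = a := by rw [real_inner_comm, ha]
    have hb' : ⟪v, e₁⟫ = b := by rw [real_inner_comm, hb]
    have hw := hagree (v - a • e₀ - b • e₁)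
      (by simp only [inner_sub_right, inner_smul_right, h00, horth, ← ha]; ring)
      (by simp only [inner_sub_right, inner_smul_right, h11, h10, ← hb]; ring)
    have hbessel : a ^ 2 + b ^ 2 ≤ ‖v‖ ^ 2 := by
      have h := real_inner_self_nonneg (x := v - a • e₀ - b • e₁)
      simp only [inner_sub_right, inner_sub_left, real_inner_smul_left, inner_smul_right,
        h00, h11, h10, horth, ha', hb', ← ha, ← hb, real_inner_self_eq_norm_sq v] at h
      nlinarith
    have heq : A v - B v = a • (A e₀ - B e₀) + b • (A e₁ - B e₁) := by
      simp only [map_sub, map_smul] at hw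
      rw [sub_eq_iff_eq_add] at hw
      rw [sub_eq_iff_eq_add] at hw
      rw [hw]
      module
    have hab : |a| + |b| ≤ Real.sqrt 2 * ‖v‖ := by
      apply abs_le_of_sq_le_sq' _ (by positivity) |>.2
      rw [mul_pow, Real.sq_sqrt (by norm_num)]
      nlinarith [sq_nonneg (|a| - |b|), sq_abs a, sq_abs b]
    calc ‖A v - B v‖ ≤ |a| * ‖A e₀ - B e₀‖ + |b| * ‖A e₁ - B e₁‖ := by
          rw [heq]
          refine (norm_add_le _ _).trans_eq ?_
          rw [norm_smul, norm_smul, Real.norm_eq_abs, Real.norm_eq_abs]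
      _ ≤ |a| * ε + |b| * ε := by gcongr
      _ = (|a| + |b|) * ε := by ring
      _ ≤ (Real.sqrt 2 * ‖v‖) * ε := by gcongr
      _ = _ := by ring
  have hn : ∀ W : H →L[ℝ] H, W ∈ unitary (H →L[ℝ] H) → ∀ v, ‖W v‖ = ‖v‖ := by
    intro W hW v
    exact ContinuousLinearMap.norm_map_of_mem_unitary hW v
  have hnB : ∀ n, ‖hybridProductR B U n x‖ = 1 := by
    intro n
    induction n with
    | zero => simp only [hybridProductR]; rw [hn _ (hU 0), hx]
    | succ n ih =>
      simp only [hybridProductR, ContinuousLinearMap.comp_apply]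
      rw [hn _ (hU _), hn _ hB, ih]
  induction T with
  | zero => simp [hybridProductR]
  | succ n ih =>
    simp only [hybridProductR, ContinuousLinearMap.comp_apply]
    rw [← map_sub, hn _ (hU _)]
    have h1 := key (hybridProductR B U n x)
    rw [hnB n] at h1
    have h2 : ‖A (hybridProductR A U n x) - A (hybridProductR B U n x)‖
        ≤ Real.sqrt 2 * n * ε := by
      rw [← map_sub, hn _ hA]; exact ih
    have h3 := norm_sub_le_norm_sub_add_norm_sub (A (hybridProductR A U n x))
      (A (hybridProductR B U n x)) (B (hybridProductR B U n x))
    push_cast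
    linarith
end

section
/- Let E be a real inner product space, let n, s be natural numbers with s ≥ 1, and let φ : Fin n → E be a family of vectors such that (i) for each i, the set { j : ⟨φ_i, φ_j⟩ ≠ 0 } has at most s elements, and (ii) ‖φ_i‖² ≤ c for all i, for some c ≥ 0. Then for every r ∈ E, ∑_i ⟨φ_i, r⟩² ≤ s · c · ‖r‖². -/
open scoped RealInnerProductSpace

/-- If each vector of the family `φ` has a Gram row with at most `s` nonzero entries and
squared norm at most `c`, then `∑ i, ⟨φ i, r⟩² ≤ s · c · ‖r‖²` for every `r`. -/
theorem sum_inner_sq_le_sparsity_mul_norm_bound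
    {E : Type*} [NormedAddCommGroup E] [InnerProductSpace ℝ E]
    (n s : ℕ) (hs : 1 ≤ s) (φ : Fin n → E)
    (hsparse : ∀ i, (Finset.univ.filter (fun j => ⟪φ i, φ j⟫ ≠ 0)).card ≤ s)
    (c : ℝ) (hc : 0 ≤ c) (hnorm : ∀ i, ‖φ i‖ ^ 2 ≤ c) (r : E) :
    ∑ i, ⟪φ i, r⟫ ^ 2 ≤ s * c * ‖r‖ ^ 2 := by
  have hW : ∀ i j, |⟪φ i, φ j⟫| ≤ c := by
    intro i j
    have h1 := abs_real_inner_le_norm (φ i) (φ j)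
    nlinarith [hnorm i, hnorm j, sq_nonneg (‖φ i‖ - ‖φ j‖)]
  have hrow : ∀ i, ∑ j, |⟪φ i, φ j⟫| ≤ s * c := by
    intro i
    have h1 : ∑ j, |⟪φ i, φ j⟫|
        = ∑ j ∈ Finset.univ.filter (fun j => ⟪φ i, φ j⟫ ≠ 0), |⟪φ i, φ j⟫| := by
      symm
      apply Finset.sum_subset (Finset.subset_univ _)
      intro j _ hj
      simpa using hj
    rw [h1]
    refine (Finset.sum_le_card_nsmul _ _ c (fun j _ => hW i j)).trans ?_
    rw [nsmul_eq_mul]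
    exact mul_le_mul_of_nonneg_right (by exact_mod_cast hsparse i) hc
  set a : Fin n → ℝ := fun i => ⟪φ i, r⟫ with ha
  set v : E := ∑ i, a i • φ i with hv
  set A : ℝ := ∑ i, ⟪φ i, r⟫ ^ 2 with hA
  have hA0 : 0 ≤ A := Finset.sum_nonneg (fun i _ => sq_nonneg _)
  have hAv : A = ⟪v, r⟫ := by
    rw [hv, sum_inner, hA]
    refine Finset.sum_congr rfl (fun i _ => ?_)
    rw [real_inner_smul_left, sq]
  have hvv : ‖v‖ ^ 2 = ∑ i, ∑ j, a i * a j * ⟪φ i, φ j⟫ := by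
    rw [← real_inner_self_eq_norm_sq, hv, sum_inner]
    refine Finset.sum_congr rfl (fun i _ => ?_)
    rw [inner_sum]
    refine Finset.sum_congr rfl (fun j _ => ?_)
    rw [real_inner_smul_left, real_inner_smul_right]
    ring
  have hdiag : ∑ i, ∑ j, a i ^ 2 * |⟪φ i, φ j⟫| ≤ s * c * A := by
    rw [hA, Finset.mul_sum]
    refine Finset.sum_le_sum (fun i _ => ?_)
    rw [← Finset.mul_sum, mul_comm]
    exact mul_le_mul_of_nonneg_right (hrow i) (sq_nonneg _)
  have hswap : ∑ i, ∑ j, a j ^ 2 * |⟪φ i, φ j⟫| = ∑ i, ∑ j, a i ^ 2 * |⟪φ i, φ j⟫| := by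
    rw [Finset.sum_comm]
    refine Finset.sum_congr rfl (fun i _ => Finset.sum_congr rfl (fun j _ => ?_))
    rw [real_inner_comm]
  have hle : 2 * ∑ i, ∑ j, a i * a j * ⟪φ i, φ j⟫
      ≤ ∑ i, ∑ j, a i ^ 2 * |⟪φ i, φ j⟫| + ∑ i, ∑ j, a j ^ 2 * |⟪φ i, φ j⟫| := by
    rw [← Finset.sum_add_distrib, Finset.mul_sum]
    refine Finset.sum_le_sum (fun i _ => ?_)
    rw [← Finset.sum_add_distrib, Finset.mul_sum]
    refine Finset.sum_le_sum (fun j _ => ?_)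
    generalize ⟪φ i, φ j⟫ = w
    rcases abs_cases w with ⟨h, h'⟩ | ⟨h, h'⟩ <;> rw [h]
    · nlinarith [mul_nonneg h' (sq_nonneg (a i - a j))]
    · nlinarith [mul_nonneg (neg_nonneg.2 h'.le) (sq_nonneg (a i + a j))]
  have hv2 : ‖v‖ ^ 2 ≤ s * c * A := by rw [hvv]; linarith
  have hCS : A ≤ ‖v‖ * ‖r‖ := hAv ▸ real_inner_le_norm v r
  have hAA : A * A ≤ (s * c * ‖r‖ ^ 2) * A := by
    calc A * A ≤ (‖v‖ * ‖r‖) * (‖v‖ * ‖r‖) := mul_self_le_mul_self hA0 hCS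
      _ = ‖v‖ ^ 2 * ‖r‖ ^ 2 := by ring
      _ ≤ (s * c * A) * ‖r‖ ^ 2 := mul_le_mul_of_nonneg_right hv2 (sq_nonneg _)
      _ = _ := by ring
  rcases hA0.eq_or_lt with h0 | h0
  · rw [← h0]; positivity
  · exact le_of_mul_le_mul_right hAA h0
end
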